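/- Let Ω ⊆ ℝ^d be a measurable set of finite Lebesgue measure and let θ ∈ (0,1) be such that 0 < ρ_θ(Ω) < ∞. Then there exists a point x ∈ ℝ^d such that |Ω ∩ B_{ρ_θ(Ω)}(x)| ≥ θ |B_{ρ_θ(Ω)}(x)| (i.e., the near-extremal points in the definition of ρ_θ(Ω) can be taken with ε = 0 when |Ω| < ∞). -/

import Mathlib

open MeasureTheory
open scoped ENNReal

/-- The regularized inradius `ρ_θ(Ω)`: the infimum (in `ℝ≥0∞`, with `inf ∅ = ∞`) of all
`ρ > 0` such that `|Ω ∩ B_ρ(x)| ≤ θ |B_ρ(x)|` for all `x ∈ ℝ^d`. -/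
noncomputable def regInradius (d : ℕ) (θ : ℝ) (Ω : Set (EuclideanSpace ℝ (Fin d))) : ℝ≥0∞ :=
  sInf (ENNReal.ofReal ''
    {ρ : ℝ | 0 < ρ ∧ ∀ x : EuclideanSpace ℝ (Fin d),
      volume (Ω ∩ Metric.ball x ρ) ≤ ENNReal.ofReal θ * volume (Metric.ball x ρ)})


/-- If `|Ω| < ∞` and `0 < ρ_θ(Ω) < ∞`, the near-extremal points in the definition of
`ρ_θ(Ω)` can be taken with `ε = 0`: there is `x ∈ ℝ^d` with
`|Ω ∩ B_{ρ_θ(Ω)}(x)| ≥ θ |B_{ρ_θ(Ω)}(x)|`. -/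
theorem regInradius_extremal_of_finite_measure
    (d : ℕ) (Ω : Set (EuclideanSpace ℝ (Fin d))) (hΩmeas : MeasurableSet Ω)
    (hΩfin : volume Ω < ∞)
    (θ : ℝ) (hθ : θ ∈ Set.Ioo (0 : ℝ) 1)
    (hpos : 0 < regInradius d θ Ω) (hfin : regInradius d θ Ω < ∞) :
    ∃ x : EuclideanSpace ℝ (Fin d),
      ENNReal.ofReal θ * volume (Metric.ball x (regInradius d θ Ω).toReal) ≤
        volume (Ω ∩ Metric.ball x (regInradius d θ Ω).toReal) := by
  set R : ℝ := (regInradius d θ Ω).toReal with hR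
  have hRpos : 0 < R := ENNReal.toReal_pos hpos.ne' hfin.ne
  have hex : ∀ ρ : ℝ, 0 < ρ → ρ < R → ∃ x : EuclideanSpace ℝ (Fin d),
      ENNReal.ofReal θ * volume (Metric.ball x ρ) < volume (Ω ∩ Metric.ball x ρ) := by
    intro ρ h0 h1
    by_contra! hcon
    have hle : regInradius d θ Ω ≤ ENNReal.ofReal ρ := sInf_le ⟨ρ, ⟨h0, hcon⟩, rfl⟩
    have : R ≤ ρ := ENNReal.toReal_le_of_le_ofReal h0.le hle
    linarith
  obtain ⟨u, -, hu, hulim⟩ := exists_seq_strictMono_tendsto' (show R / 2 < R by linarith)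
  have hu0 : ∀ n, 0 < u n := fun n => by have := (hu n).1; linarith
  choose x hx using fun n => hex (u n) (hu0 n) (hu n).2
  have hθ0 : ENNReal.ofReal θ ≠ 0 := by simpa using hθ.1
  -- a compact part of `Ω` carrying almost all the mass
  obtain ⟨K, -, hK, hKlt⟩ := hΩmeas.exists_isCompact_sdiff_lt hΩfin.ne
    (ε := ENNReal.ofReal θ * volume (Metric.ball (0 : EuclideanSpace ℝ (Fin d)) (R / 2)))
    (mul_ne_zero hθ0 (Metric.measure_ball_pos _ _ (by linarith)).ne')
  have hmem : ∀ n, x n ∈ Metric.cthickening R K := by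
    intro n
    by_contra hn
    have hsub : Ω ∩ Metric.ball (x n) (u n) ⊆ Ω \ K := by
      rintro z ⟨hz, hzb⟩
      refine ⟨hz, fun hzK => hn ?_⟩
      refine Metric.mem_cthickening_of_dist_le _ z _ _ hzK ?_
      rw [dist_comm]
      exact (Metric.mem_ball.1 hzb).le.trans (hu n).2.le
    have h1 := (hx n).trans_le (measure_mono hsub)
    have h2 : volume (Metric.ball (0 : EuclideanSpace ℝ (Fin d)) (R / 2)) ≤
        volume (Metric.ball (x n) (u n)) := by
      rw [Measure.addHaar_ball_center volume (x n)]
      exact measure_mono (Metric.ball_subset_ball (hu n).1.le)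
    exact absurd ((h1.trans hKlt).trans_le (mul_le_mul_right h2 _)) (lt_irrefl _)
  obtain ⟨y, -, φ, hφ, hlim⟩ := hK.cthickening.tendsto_subseq hmem
  refine ⟨y, ?_⟩
  have hball : Filter.Tendsto (fun n => volume (Metric.ball (x (φ n)) (u (φ n))))
      Filter.atTop (nhds (volume (Metric.ball y R))) := by
    have he : ∀ n, volume (Metric.ball (x (φ n)) (u (φ n))) = _ :=
      fun n => Measure.addHaar_ball_of_pos volume (x (φ n)) (hu0 (φ n))
    rw [Measure.addHaar_ball_of_pos volume y hRpos]
    refine Filter.Tendsto.congr (fun n => (he n).symm) ?_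
    refine ENNReal.Tendsto.mul_const (ENNReal.tendsto_ofReal
      ((hulim.comp hφ.tendsto_atTop).pow _)) (Or.inr measure_ball_lt_top.ne)
  have hL := ENNReal.Tendsto.const_mul (a := ENNReal.ofReal θ) hball
    (Or.inr ENNReal.ofReal_ne_top)
  have hdist : Filter.Tendsto (fun n => dist (x (φ n)) y) Filter.atTop (nhds 0) :=
    tendsto_iff_dist_tendsto_zero.1 hlim
  have hRt := (tendsto_measure_cthickening_of_isCompact (μ := volume.restrict Ω)
    (isCompact_closedBall y R)).comp hdist
  have hfinal := le_of_tendsto_of_tendsto' hL hRt (fun n => by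
    refine (hx (φ n)).le.trans ?_
    simp only [Function.comp]
    rw [Measure.restrict_apply Metric.isClosed_cthickening.measurableSet, Set.inter_comm]
    refine measure_mono (Set.inter_subset_inter_left _ ?_)
    intro z hz
    refine Metric.mem_cthickening_of_dist_le z (z - x (φ n) + y) _ _ ?_ ?_
    · rw [Metric.mem_closedBall, dist_eq_norm, add_sub_cancel_right, ← dist_eq_norm]
      exact (Metric.mem_ball.1 hz).le.trans (hu _).2.le
    · rw [dist_eq_norm, dist_eq_norm]
      apply le_of_eq
      congr 1
      abel)
  refine hfinal.trans ?_
  rw [← Metric.ball_union_sphere]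
  refine (measure_union_le _ _).trans ?_
  have hs : volume.restrict Ω (Metric.sphere y R) = 0 :=
    le_antisymm ((Measure.restrict_apply_le _ _).trans
      (Measure.addHaar_sphere_of_ne_zero volume y hRpos.ne').le) zero_le
  rw [hs, add_zero, Measure.restrict_apply measurableSet_ball, Set.inter_comm]
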